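/- For f = x^5 + x y^3 z + y^4 z + x y^4 in C[x,y,z], the Hilbert function μ_k of the Milnor algebra C[x,y,z]/(∂f) (graded with deg shifted by 3, as in the paper's table) satisfies μ_6 = 10, μ_7 = 12, μ_8 = 12, μ_9 = 11, and μ_k = 10 for all k ≥ 10. -/

import Mathlib

open MvPolynomial

namespace MilnorAlgebra

/-- If every monomial of degree `d` has its image in `W`, so does every form of degree `d`. -/
lemma map_homogeneousSubmodule_le {R : Type*} [CommRing R] [Algebra ℂ R]
    (φ : MvPolynomial (Fin 3) ℂ →ₐ[ℂ] R) (d : ℕ) (W : Submodule ℂ R)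
    (h : ∀ a b c, a + b + c = d → φ (X 0) ^ a * φ (X 1) ^ b * φ (X 2) ^ c ∈ W) :
    Submodule.map φ.toLinearMap (homogeneousSubmodule (Fin 3) ℂ d) ≤ W := by
  rintro _ ⟨p, hp, rfl⟩
  rw [SetLike.mem_coe, mem_homogeneousSubmodule] at hp
  rw [AlgHom.toLinearMap_apply, p.as_sum, map_sum]
  refine Submodule.sum_mem _ fun m hm => ?_
  have hdeg := hp (mem_support_iff.mp hm)
  rw [monomial_eq, Finsupp.prod_fintype _ _ (by simp), Fin.prod_univ_three, ← smul_eq_C_mul,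
    map_smul]
  refine W.smul_mem _ ?_
  simp only [map_mul, map_pow]
  refine h _ _ _ ?_
  rw [← hdeg, Finsupp.weight_apply, Finsupp.sum_fintype _ _ (by simp), Fin.sum_univ_three]
  simp

/-- The linear functional on polynomials with prescribed values on the monomials. -/
noncomputable def functional (w : ℕ → ℕ → ℕ → ℂ) : MvPolynomial (Fin 3) ℂ →ₗ[ℂ] ℂ :=
  (basisMonomials (Fin 3) ℂ).constr ℂ fun m => w (m 0) (m 1) (m 2)

lemma monomial_eq_X_pow (m : Fin 3 →₀ ℕ) (r : ℂ) :
    monomial m r = r • (X 0 ^ m 0 * X 1 ^ m 1 * X 2 ^ m 2 : MvPolynomial (Fin 3) ℂ) := by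
  rw [monomial_eq, Finsupp.prod_fintype _ _ (by simp), Fin.prod_univ_three, ← smul_eq_C_mul]

lemma functional_X_pow (w : ℕ → ℕ → ℕ → ℂ) (a b c : ℕ) :
    functional w (X 0 ^ a * X 1 ^ b * X 2 ^ c) = w a b c := by
  have h := monomial_eq_X_pow (Finsupp.equivFunOnFinite.symm ![a, b, c]) 1
  simp only [one_smul, Finsupp.equivFunOnFinite_symm_apply_apply, Matrix.cons_val] at h
  rw [← h, functional, ← congrFun (coe_basisMonomials (Fin 3) ℂ), Module.Basis.constr_basis]
  simp

/-- The weights whose functional vanishes on the Jacobian ideal of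
`x ^ 5 + x y ^ 3 z + y ^ 4 z + x y ^ 4`. -/
def IsOrthogonal {K : Type*} [Semiring K] (w : ℕ → ℕ → ℕ → K) : Prop := ∀ a b c,
  5 * w (a + 4) b c + w a (b + 3) (c + 1) + w a (b + 4) c = 0 ∧
  3 * w (a + 1) (b + 2) (c + 1) + 4 * w a (b + 3) (c + 1) + 4 * w (a + 1) (b + 3) c = 0 ∧
  w (a + 1) (b + 3) c + w a (b + 4) c = 0

lemma IsOrthogonal.cast {w : ℕ → ℕ → ℕ → ℚ} (hw : IsOrthogonal w) :
    IsOrthogonal fun a b c => (w a b c : ℂ) := by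
  intro a b c
  beta_reduce
  exact_mod_cast hw a b c

/-- The Jacobian ideal of `x ^ 5 + x y ^ 3 z + y ^ 4 z + x y ^ 4`. -/
noncomputable def jacobianIdeal : Ideal (MvPolynomial (Fin 3) ℂ) :=
  Ideal.span {5 * X 0 ^ 4 + X 1 ^ 3 * X 2 + X 1 ^ 4,
    3 * X 0 * X 1 ^ 2 * X 2 + 4 * X 1 ^ 3 * X 2 + 4 * X 0 * X 1 ^ 3,
    X 0 * X 1 ^ 3 + X 1 ^ 4}

lemma functional_mul_eq_zero (w : ℕ → ℕ → ℕ → ℂ) (g : MvPolynomial (Fin 3) ℂ)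
    (h : ∀ a b c, functional w (X 0 ^ a * X 1 ^ b * X 2 ^ c * g) = 0)
    (p : MvPolynomial (Fin 3) ℂ) : functional w (p * g) = 0 := by
  rw [p.as_sum, Finset.sum_mul, map_sum]
  refine Finset.sum_eq_zero fun m _ => ?_
  rw [monomial_eq_X_pow, smul_mul_assoc, map_smul, h, smul_zero]

lemma IsOrthogonal.functional_eq_zero {w : ℕ → ℕ → ℕ → ℂ} (hw : IsOrthogonal w)
    {p : MvPolynomial (Fin 3) ℂ} (hp : p ∈ jacobianIdeal) : functional w p = 0 := by
  rw [jacobianIdeal, Ideal.mem_span_insert] at hp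
  obtain ⟨r, q, hq, rfl⟩ := hp
  rw [Ideal.mem_span_pair] at hq
  obtain ⟨s, t, rfl⟩ := hq
  rw [map_add, map_add, functional_mul_eq_zero, functional_mul_eq_zero, functional_mul_eq_zero]
  · simp
  · intro a b c
    rw [← (hw a b c).2.2]
    simp only [← functional_X_pow, ← map_add]
    congr 1
    ring
  · intro a b c
    rw [← (hw a b c).2.1]
    simp only [← functional_X_pow, ← smul_eq_mul, ← map_smul, ← map_add]
    congr 1
    simp only [smul_eq_C_mul, smul_eq_mul, map_ofNat]
    ring
  · intro a b c
    rw [← (hw a b c).1]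
    simp only [← functional_X_pow, ← smul_eq_mul, ← map_smul, ← map_add]
    congr 1
    simp only [smul_eq_C_mul, smul_eq_mul, map_ofNat]
    ring

/-- Monomials of degree `d` that span the degree `d` piece of the Milnor algebra and admit a dual
family of functionals form a basis of it. -/
lemma finrank_eq {n d : ℕ} (e : Fin n → ℕ × ℕ × ℕ) (w : Fin n → ℕ → ℕ → ℕ → ℚ)
    (he : ∀ i, (e i).1 + (e i).2.1 + (e i).2.2 = d) (hw : ∀ i, IsOrthogonal (w i))
    (hdual : ∀ i j, w i (e j).1 (e j).2.1 (e j).2.2 = if i = j then 1 else 0)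
    (hspan : ∀ W : Submodule ℂ (MvPolynomial (Fin 3) ℂ ⧸ jacobianIdeal),
      (∀ i, Ideal.Quotient.mkₐ ℂ jacobianIdeal (X 0) ^ (e i).1 *
        Ideal.Quotient.mkₐ ℂ jacobianIdeal (X 1) ^ (e i).2.1 *
        Ideal.Quotient.mkₐ ℂ jacobianIdeal (X 2) ^ (e i).2.2 ∈ W) →
      ∀ a b c, a + b + c = d → Ideal.Quotient.mkₐ ℂ jacobianIdeal (X 0) ^ a *
        Ideal.Quotient.mkₐ ℂ jacobianIdeal (X 1) ^ b *
        Ideal.Quotient.mkₐ ℂ jacobianIdeal (X 2) ^ c ∈ W) :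
    Module.finrank ℂ (Submodule.map (Ideal.Quotient.mkₐ ℂ jacobianIdeal).toLinearMap
        (homogeneousSubmodule (Fin 3) ℂ d)) = n := by
  set φ := Ideal.Quotient.mkₐ ℂ jacobianIdeal with hφ
  let s : Fin n → MvPolynomial (Fin 3) ℂ :=
    fun i => X 0 ^ (e i).1 * X 1 ^ (e i).2.1 * X 2 ^ (e i).2.2
  have hs : ∀ i, φ (s i) = φ (X 0) ^ (e i).1 * φ (X 1) ^ (e i).2.1 * φ (X 2) ^ (e i).2.2 := by
    simp [s]
  have hmap : Submodule.map φ.toLinearMap (homogeneousSubmodule (Fin 3) ℂ d) =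
      Submodule.span ℂ (Set.range fun i => φ (s i)) := by
    refine le_antisymm (map_homogeneousSubmodule_le φ d _ (hspan _ fun i => ?_)) ?_
    · rw [← hs]
      exact Submodule.subset_span ⟨i, rfl⟩
    · rw [Submodule.span_le]
      rintro _ ⟨i, rfl⟩
      refine ⟨s i, ?_, rfl⟩
      rw [SetLike.mem_coe, mem_homogeneousSubmodule, ← he i]
      exact ((isHomogeneous_X_pow _ _).mul (isHomogeneous_X_pow _ _)).mul (isHomogeneous_X_pow _ _)
  have hli : LinearIndependent ℂ fun i => φ (s i) := by
    rw [Fintype.linearIndependent_iff]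
    intro g hg i
    simp only [← map_smul, ← map_sum] at hg
    rw [hφ, Ideal.Quotient.mkₐ_eq_mk, Ideal.Quotient.eq_zero_iff_mem] at hg
    have h := (hw i).cast.functional_eq_zero hg
    simpa [s, functional_X_pow, hdual, apply_ite (Rat.cast : ℚ → ℂ)] using h
  rw [hmap, finrank_span_eq_card hli, Fintype.card_fin]

section Weights

/-- The weight picking out the coefficients of `x ^ p y ^ q z ^ c` for all `c`. -/
def coeffXY (p q : ℕ) : ℕ → ℕ → ℕ → ℚ := fun a b _ => if a = p ∧ b = q then 1 else 0

/-- The weight picking out the coefficient of `x ^ p y ^ q z ^ r`. -/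
def coeffXYZ (p q r : ℕ) : ℕ → ℕ → ℕ → ℚ := fun a b c => if a = p ∧ b = q ∧ c = r then 1 else 0

/-- The coefficient of `y ^ 3` in the Tjurina algebra of the singular point `(0 : 0 : 1)`. -/
def coeffYCubed : ℕ → ℕ → ℕ → ℚ := fun a b _ =>
  if a = 0 ∧ b = 3 then 1 else if a = 1 ∧ b = 2 then -4 / 3 else if a = 4 ∧ b = 0 then -1 / 5 else 0

/-- In degrees `4 ≤ d ≤ 6`, the coefficient of `y ^ 4 z ^ (d - 4)` in normal forms. -/
def coeffYFourth : ℕ → ℕ → ℕ → ℚ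
  | 0, 4, 0 => 1
  | 1, 3, 0 => -1
  | 1, 2, 1 => 4 / 3
  | 4, 0, 0 => -1 / 5
  | 0, 4, 1 => 1
  | 0, 5, 0 => 1 / 4
  | 5, 0, 0 => 1 / 4
  | 4, 1, 0 => -1 / 4
  | 4, 0, 1 => -1 / 5
  | 2, 3, 0 => 1 / 4
  | 1, 4, 0 => -1 / 4
  | 1, 3, 1 => -1
  | 1, 2, 2 => 4 / 3
  | 2, 2, 1 => 1
  | 0, 6, 0 => 1 / 16
  | 1, 5, 0 => -1 / 16
  | 2, 4, 0 => 1 / 16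
  | 3, 3, 0 => -1 / 16
  | 4, 2, 0 => -1 / 16
  | 5, 1, 0 => 1 / 16
  | 6, 0, 0 => -1 / 16
  | 0, 5, 1 => 1 / 4
  | 1, 4, 1 => -1 / 4
  | 2, 3, 1 => 1 / 4
  | 3, 2, 1 => -1 / 4
  | 4, 1, 1 => -1 / 4
  | 5, 0, 1 => 1 / 4
  | 0, 4, 2 => 1
  | 1, 3, 2 => -1
  | 2, 2, 2 => 1
  | 4, 0, 2 => -1 / 5
  | 1, 2, 3 => 4 / 3
  | _, _, _ => 0

lemma isOrthogonal_coeffXY {p q : ℕ} (hp : p < 4) (hq : q < 3) (h : p = 0 ∨ q < 2) :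
    IsOrthogonal (coeffXY p q) := by
  intro a b c
  have h1 : ¬ (a + 4 = p ∧ b = q) := by omega
  have h2 : ¬ (a = p ∧ b + 3 = q) := by omega
  have h3 : ¬ (a = p ∧ b + 4 = q) := by omega
  have h4 : ¬ (a + 1 = p ∧ b + 2 = q) := by omega
  have h5 : ¬ (a + 1 = p ∧ b + 3 = q) := by omega
  simp [coeffXY, h1, h2, h3, h4, h5]

lemma isOrthogonal_coeffXYZ {p q r : ℕ} (hp : p < 4) (hq : q < 3 ∨ p = 0 ∧ q < 4 ∧ r = 0)
    (h : p = 0 ∨ q < 2 ∨ r = 0) : IsOrthogonal (coeffXYZ p q r) := by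
  intro a b c
  have h1 : ¬ (a + 4 = p ∧ b = q ∧ c = r) := by omega
  have h2 : ¬ (a = p ∧ b + 3 = q ∧ c + 1 = r) := by omega
  have h3 : ¬ (a = p ∧ b + 4 = q ∧ c = r) := by omega
  have h4 : ¬ (a + 1 = p ∧ b + 2 = q ∧ c + 1 = r) := by omega
  have h5 : ¬ (a + 1 = p ∧ b + 3 = q ∧ c = r) := by omega
  simp [coeffXYZ, h1, h2, h3, h4, h5]

lemma isOrthogonal_coeffYCubed : IsOrthogonal coeffYCubed := by
  intro a b c
  have h1 : b + 4 ≠ 3 := by omega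
  have h2 : b + 3 ≠ 2 := by omega
  have h3 : b + 4 ≠ 2 := by omega
  have h4 : a + 4 ≠ 1 := by omega
  by_cases ha : a = 0 <;> by_cases hb : b = 0 <;> norm_num [coeffYCubed, *]

lemma coeffYFourth_eq_zero {a b c : ℕ} (h : a + b + c < 4 ∨ 6 < a + b + c) :
    coeffYFourth a b c = 0 := by
  unfold coeffYFourth
  split <;> first | rfl | omega

lemma isOrthogonal_coeffYFourth : IsOrthogonal coeffYFourth := by
  intro a b c
  by_cases h : a + b + c ≤ 2
  · have ha : a ≤ 2 := by omega
    have hb : b ≤ 2 := by omega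
    have hc : c ≤ 2 := by omega
    interval_cases a <;> interval_cases b <;> interval_cases c <;>
      first | omega | norm_num [coeffYFourth]
  · iterate 5 rw [coeffYFourth_eq_zero (by omega)]
    simp

end Weights

section Spanning

variable {R : Type*} [CommRing R] {x y z : R}

/-- The relations of the Milnor algebra of `x ^ 5 + x y ^ 3 z + y ^ 4 z + x y ^ 4`. -/
structure Relations (x y z : R) : Prop where
  dx : 5 * x ^ 4 + y ^ 3 * z + y ^ 4 = 0
  dy : 3 * x * y ^ 2 * z + 4 * y ^ 3 * z + 4 * x * y ^ 3 = 0
  dz : x * y ^ 3 + y ^ 4 = 0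

namespace Relations

lemma four_mul_y_pow_five (h : Relations x y z) : 4 * y ^ 5 = y ^ 4 * z := by
  linear_combination -y * h.dy + (3 * z + 4 * y) * h.dz

lemma three_mul_x_sq_y_sq_z (h : Relations x y z) : 3 * (x ^ 2 * y ^ 2 * z) = 3 * (y ^ 4 * z) := by
  linear_combination x * h.dy - 4 * (z + x - y) * h.dz - h.four_mul_y_pow_five

lemma four_mul_x_y_pow_four (h : Relations x y z) : 4 * (x * y ^ 4) = -(y ^ 4 * z) := by
  linear_combination 4 * y * h.dz - h.four_mul_y_pow_five

lemma twelve_mul_x_cubed_y_sq_z (h : Relations x y z) :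
    12 * (x ^ 3 * y ^ 2 * z) = -(3 * (y ^ 4 * z ^ 2)) := by
  linear_combination 4 * x * h.three_mul_x_sq_y_sq_z + 3 * z * h.four_mul_x_y_pow_four

lemma twenty_mul_x_pow_four_y (h : Relations x y z) : 20 * (x ^ 4 * y) = -(5 * (y ^ 4 * z)) := by
  linear_combination 4 * y * h.dx - h.four_mul_y_pow_five

variable [Algebra ℂ R]

lemma mem_of_ofNat_mul_mem {W : Submodule ℂ R} (n : ℕ) [n.AtLeastTwo] {v : R}
    (h : (ofNat(n) : R) * v ∈ W) : v ∈ W := by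
  have hn : (ofNat(n) : ℂ) ≠ 0 := OfNat.ofNat_ne_zero n
  rw [← W.smul_mem_iff hn, Algebra.smul_def, map_ofNat]
  exact h

lemma ofNat_mul_mem {W : Submodule ℂ R} (n : ℕ) [n.AtLeastTwo] {v : R}
    (h : v ∈ W) : (ofNat(n) : R) * v ∈ W := by
  have := W.smul_mem (ofNat(n) : ℂ) h
  rwa [Algebra.smul_def, map_ofNat] at this

lemma y_pow_four_z_cubed (h : Relations x y z) : y ^ 4 * z ^ 3 = 0 := by
  rw [← Submodule.mem_bot (R := ℂ)]
  refine mem_of_ofNat_mul_mem 30 ?_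
  rw [Submodule.mem_bot]
  linear_combination 12 * y * z * h.twenty_mul_x_pow_four_y
    - 20 * x * h.twelve_mul_x_cubed_y_sq_z + 15 * z ^ 2 * h.four_mul_x_y_pow_four
    - 15 * z ^ 2 * h.four_mul_y_pow_five

lemma mem_of_degree_four (h : Relations x y z) (W : Submodule ℂ R)
    (hW : ∀ a b c, a + b + c = 4 → a < 4 → (a = 0 ∨ b < 2 ∨ a = 2 ∧ b = 2) →
      x ^ a * y ^ b * z ^ c ∈ W) (a b c : ℕ) (hd : a + b + c = 4) :
    x ^ a * y ^ b * z ^ c ∈ W := by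
  have h1 := hW 0 4 0 rfl (by omega) (by omega)
  have h2 := hW 0 3 1 rfl (by omega) (by omega)
  by_cases hs : a < 4 ∧ (a = 0 ∨ b < 2 ∨ a = 2 ∧ b = 2)
  · exact hW a b c hd hs.1 hs.2
  have : (a = 4 ∧ b = 0 ∧ c = 0) ∨ (a = 1 ∧ b = 2 ∧ c = 1) ∨ (a = 1 ∧ b = 3 ∧ c = 0) := by omega
  rcases this with ⟨rfl, rfl, rfl⟩ | ⟨rfl, rfl, rfl⟩ | ⟨rfl, rfl, rfl⟩
  · refine mem_of_ofNat_mul_mem 5 ?_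
    convert W.neg_mem (W.add_mem h1 h2) using 1
    linear_combination h.dx
  · refine mem_of_ofNat_mul_mem 3 ?_
    convert ofNat_mul_mem 4 (W.sub_mem h1 h2) using 1
    linear_combination h.dy - 4 * h.dz
  · convert W.neg_mem h1 using 1
    linear_combination h.dz

lemma mem_of_degree_five (h : Relations x y z) (W : Submodule ℂ R)
    (hW : ∀ a b c, a + b + c = 5 → a < 4 → b < 5 → (a = 0 ∨ b < 2 ∨ a = 3 ∧ b = 2) →
      x ^ a * y ^ b * z ^ c ∈ W) (a b c : ℕ) (hd : a + b + c = 5) :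
    x ^ a * y ^ b * z ^ c ∈ W := by
  have h1 := hW 0 4 1 rfl (by omega) (by omega) (by omega)
  have h2 := hW 0 3 2 rfl (by omega) (by omega) (by omega)
  by_cases hs : a < 4 ∧ b < 5 ∧ (a = 0 ∨ b < 2 ∨ a = 3 ∧ b = 2)
  · exact hW a b c hd hs.1 hs.2.1 hs.2.2
  have : (a = 5 ∧ b = 0 ∧ c = 0) ∨ (a = 4 ∧ b = 1 ∧ c = 0) ∨ (a = 4 ∧ b = 0 ∧ c = 1) ∨
      (a = 2 ∧ b = 3 ∧ c = 0) ∨ (a = 2 ∧ b = 2 ∧ c = 1) ∨ (a = 1 ∧ b = 4 ∧ c = 0) ∨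
      (a = 1 ∧ b = 3 ∧ c = 1) ∨ (a = 1 ∧ b = 2 ∧ c = 2) ∨ (a = 0 ∧ b = 5 ∧ c = 0) := by
    have ha : a ≤ 5 := by omega
    have hb : b ≤ 5 := by omega
    obtain rfl : c = 5 - a - b := by omega
    clear hW h1 h2
    revert hd hs
    interval_cases a <;> interval_cases b <;> decide
  rcases this with ⟨rfl, rfl, rfl⟩ | ⟨rfl, rfl, rfl⟩ | ⟨rfl, rfl, rfl⟩ | ⟨rfl, rfl, rfl⟩ |
    ⟨rfl, rfl, rfl⟩ | ⟨rfl, rfl, rfl⟩ | ⟨rfl, rfl, rfl⟩ | ⟨rfl, rfl, rfl⟩ | ⟨rfl, rfl, rfl⟩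
  · refine mem_of_ofNat_mul_mem 20 ?_
    convert ofNat_mul_mem 5 h1 using 1
    linear_combination 4 * x * h.dx - 4 * (z + y) * h.dz + h.four_mul_y_pow_five
  · refine mem_of_ofNat_mul_mem 20 ?_
    convert W.neg_mem (ofNat_mul_mem 5 h1) using 1
    linear_combination h.twenty_mul_x_pow_four_y
  · refine mem_of_ofNat_mul_mem 5 ?_
    convert W.neg_mem (W.add_mem h1 h2) using 1
    linear_combination z * h.dx
  · refine mem_of_ofNat_mul_mem 4 ?_
    convert h1 using 1
    linear_combination 4 * (x - y) * h.dz + h.four_mul_y_pow_five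
  · refine mem_of_ofNat_mul_mem 3 ?_
    convert ofNat_mul_mem 3 h1 using 1
    linear_combination h.three_mul_x_sq_y_sq_z
  · refine mem_of_ofNat_mul_mem 4 ?_
    convert W.neg_mem h1 using 1
    linear_combination h.four_mul_x_y_pow_four
  · convert W.neg_mem h1 using 1
    linear_combination z * h.dz
  · refine mem_of_ofNat_mul_mem 3 ?_
    convert ofNat_mul_mem 4 (W.sub_mem h1 h2) using 1
    linear_combination z * h.dy - 4 * z * h.dz
  · refine mem_of_ofNat_mul_mem 4 ?_
    convert h1 using 1
    linear_combination h.four_mul_y_pow_five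

/-- Multiplication by `z` is surjective onto the pieces of degree at least six. -/
lemma mem_succ (h : Relations x y z) {d : ℕ} (hd : 5 ≤ d) (W : Submodule ℂ R)
    (hW : ∀ a b c, a + b + c = d → x ^ a * y ^ b * z ^ c * z ∈ W) (a b c : ℕ)
    (habc : a + b + c = d + 1) : x ^ a * y ^ b * z ^ c ∈ W := by
  obtain _ | c := c
  swap
  · rw [pow_succ, ← mul_assoc]
    exact hW a b c (by omega)
  have hxy : ∀ a b, a + b + 3 = d → x ^ a * y ^ b * (x * y ^ 3) ∈ W := by
    intro a b hab
    refine mem_of_ofNat_mul_mem 4 ?_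
    convert W.neg_mem (W.add_mem (ofNat_mul_mem 3 (hW (a + 1) (b + 2) 0 (by omega)))
      (ofNat_mul_mem 4 (hW a (b + 3) 0 (by omega)))) using 1
    linear_combination x ^ a * y ^ b * h.dy
  have hy : ∀ a b, a + b + 3 = d → x ^ a * y ^ b * y ^ 4 ∈ W := by
    intro a b hab
    convert W.neg_mem (hxy a b hab) using 1
    linear_combination x ^ a * y ^ b * h.dz
  have hx : ∀ a b, a + b + 3 = d → x ^ a * y ^ b * x ^ 4 ∈ W := by
    intro a b hab
    refine mem_of_ofNat_mul_mem 5 ?_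
    convert W.neg_mem (W.add_mem (hW a (b + 3) 0 (by omega)) (hy a b hab)) using 1
    linear_combination x ^ a * y ^ b * h.dx
  have : 4 ≤ a ∨ 4 ≤ b ∨ 1 ≤ a ∧ 3 ≤ b := by omega
  rcases this with ha | hb | ⟨ha, hb⟩
  · obtain ⟨a, rfl⟩ := Nat.exists_eq_add_of_le ha
    convert hx a b (by omega) using 1
    ring
  · obtain ⟨b, rfl⟩ := Nat.exists_eq_add_of_le hb
    convert hy a b (by omega) using 1
    ring
  · obtain ⟨a, rfl⟩ := Nat.exists_eq_add_of_le ha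
    obtain ⟨b, rfl⟩ := Nat.exists_eq_add_of_le hb
    convert hxy a b (by omega) using 1
    ring

lemma mem_of_degree_six (h : Relations x y z) (W : Submodule ℂ R)
    (hW : ∀ a b c, a + b + c = 6 → a < 4 → b < 5 → (a = 0 ∨ b < 2) →
      x ^ a * y ^ b * z ^ c ∈ W) (a b c : ℕ) (hd : a + b + c = 6) :
    x ^ a * y ^ b * z ^ c ∈ W := by
  refine h.mem_succ le_rfl W ?_ a b c hd
  refine h.mem_of_degree_five (W.comap (LinearMap.mulRight ℂ z)) fun a b c hd ha hb hab => ?_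
  rw [Submodule.mem_comap, LinearMap.mulRight_apply]
  by_cases hs : a = 3 ∧ b = 2
  · obtain ⟨rfl, rfl⟩ := hs
    obtain rfl : c = 0 := by omega
    refine mem_of_ofNat_mul_mem 12 ?_
    convert W.neg_mem (ofNat_mul_mem 3 (hW 0 4 2 rfl (by omega) (by omega) (by omega))) using 1
    linear_combination h.twelve_mul_x_cubed_y_sq_z
  · rw [mul_assoc, ← pow_succ]
    exact hW a b (c + 1) (by omega) ha hb (by omega)

lemma mem_of_degree_ge_seven (h : Relations x y z) {d : ℕ} (hd : 7 ≤ d) (W : Submodule ℂ R)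
    (hW : ∀ a b c, a + b + c = d → a < 4 → b < 4 → (a = 0 ∨ b < 2) →
      x ^ a * y ^ b * z ^ c ∈ W) (a b c : ℕ) (habc : a + b + c = d) :
    x ^ a * y ^ b * z ^ c ∈ W := by
  induction d, hd using Nat.le_induction generalizing W a b c with
  | base =>
    refine h.mem_succ (by norm_num) W ?_ a b c habc
    refine h.mem_of_degree_six (W.comap (LinearMap.mulRight ℂ z)) fun a b c hd ha hb hab => ?_
    rw [Submodule.mem_comap, LinearMap.mulRight_apply, mul_assoc, ← pow_succ]
    by_cases hs : b = 4
    · obtain rfl : a = 0 := by omega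
      obtain rfl : c = 2 := by omega
      rw [hs, pow_zero, one_mul, h.y_pow_four_z_cubed]
      exact W.zero_mem
    · exact hW a b (c + 1) (by omega) ha (by omega) hab
  | succ d hd ih =>
    refine h.mem_succ (by omega) W ?_ a b c habc
    refine ih (W.comap (LinearMap.mulRight ℂ z)) fun a b c hd ha hb hab => ?_
    rw [Submodule.mem_comap, LinearMap.mulRight_apply, mul_assoc, ← pow_succ]
    exact hW a b (c + 1) (by omega) ha hb hab

end Relations

end Spanning

lemma relations_quotient : Relations (Ideal.Quotient.mkₐ ℂ jacobianIdeal (X 0))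
    (Ideal.Quotient.mkₐ ℂ jacobianIdeal (X 1)) (Ideal.Quotient.mkₐ ℂ jacobianIdeal (X 2)) := by
  constructor <;>
  · simp only [← map_pow, ← map_mul, ← map_add, ← map_ofNat (Ideal.Quotient.mkₐ ℂ jacobianIdeal)]
    rw [Ideal.Quotient.mkₐ_eq_mk, Ideal.Quotient.eq_zero_iff_mem]
    exact Ideal.subset_span (by simp)

/-- The dimension of the degree `d` piece of the Milnor algebra. -/
noncomputable def milnorDim (d : ℕ) : ℕ :=
  Module.finrank ℂ (Submodule.map (Ideal.Quotient.mkₐ ℂ jacobianIdeal).toLinearMap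
    (homogeneousSubmodule (Fin 3) ℂ d))

lemma milnorDim_three : milnorDim 3 = 10 := by
  refine finrank_eq (d := 3)
    ![(0, 0, 3), (1, 0, 2), (0, 1, 2), (2, 0, 1), (1, 1, 1), (0, 2, 1), (3, 0, 0), (2, 1, 0),
      (1, 2, 0), (0, 3, 0)]
    ![coeffXYZ 0 0 3, coeffXYZ 1 0 2, coeffXYZ 0 1 2, coeffXYZ 2 0 1, coeffXYZ 1 1 1,
      coeffXYZ 0 2 1, coeffXYZ 3 0 0, coeffXYZ 2 1 0, coeffXYZ 1 2 0, coeffXYZ 0 3 0]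
    ?_ ?_ ?_ ?_
  · intro i; fin_cases i <;> rfl
  · intro i; fin_cases i <;> exact isOrthogonal_coeffXYZ (by omega) (by omega) (by omega)
  · decide +kernel
  · intro W hW a b c hd
    have hex : ∃ i, (![(0, 0, 3), (1, 0, 2), (0, 1, 2), (2, 0, 1), (1, 1, 1), (0, 2, 1),
        (3, 0, 0), (2, 1, 0), (1, 2, 0), (0, 3, 0)] : Fin 10 → ℕ × ℕ × ℕ) i = (a, b, c) := by
      have ha : a ≤ 3 := by omega
      have hb : b ≤ 3 := by omega
      obtain rfl : c = 3 - a - b := by omega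
      interval_cases a <;> interval_cases b <;> first | omega | decide
    obtain ⟨i, hi⟩ := hex
    simpa only [hi] using hW i

lemma milnorDim_four : milnorDim 4 = 12 := by
  refine finrank_eq (d := 4)
    ![(0, 0, 4), (1, 0, 3), (0, 1, 3), (2, 0, 2), (1, 1, 2), (0, 2, 2), (3, 0, 1), (2, 1, 1),
      (3, 1, 0), (0, 3, 1), (0, 4, 0), (2, 2, 0)]
    ![coeffXY 0 0, coeffXY 1 0, coeffXY 0 1, coeffXY 2 0, coeffXY 1 1, coeffXY 0 2, coeffXY 3 0,
      coeffXY 2 1, coeffXY 3 1, coeffYCubed, coeffYFourth, coeffXYZ 2 2 0]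
    ?_ ?_ ?_ ?_
  · intro i; fin_cases i <;> rfl
  · intro i
    fin_cases i <;> first
      | exact isOrthogonal_coeffXY (by omega) (by omega) (by omega)
      | exact isOrthogonal_coeffXYZ (by omega) (by omega) (by omega)
      | exact isOrthogonal_coeffYCubed
      | exact isOrthogonal_coeffYFourth
  · decide +kernel
  · intro W hW
    refine relations_quotient.mem_of_degree_four W fun a b c hd ha hab => ?_
    have hex : ∃ i, (![(0, 0, 4), (1, 0, 3), (0, 1, 3), (2, 0, 2), (1, 1, 2), (0, 2, 2),
        (3, 0, 1), (2, 1, 1), (3, 1, 0), (0, 3, 1), (0, 4, 0), (2, 2, 0)] :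
          Fin 12 → ℕ × ℕ × ℕ) i = (a, b, c) := by
      have hb : b ≤ 4 := by omega
      obtain rfl : c = 4 - a - b := by omega
      interval_cases a <;> interval_cases b <;> first | omega | decide
    obtain ⟨i, hi⟩ := hex
    simpa only [hi] using hW i

lemma milnorDim_five : milnorDim 5 = 12 := by
  refine finrank_eq (d := 5)
    ![(0, 0, 5), (1, 0, 4), (0, 1, 4), (2, 0, 3), (1, 1, 3), (0, 2, 3), (3, 0, 2), (2, 1, 2),
      (3, 1, 1), (0, 3, 2), (0, 4, 1), (3, 2, 0)]
    ![coeffXY 0 0, coeffXY 1 0, coeffXY 0 1, coeffXY 2 0, coeffXY 1 1, coeffXY 0 2, coeffXY 3 0,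
      coeffXY 2 1, coeffXY 3 1, coeffYCubed, coeffYFourth, coeffXYZ 3 2 0]
    ?_ ?_ ?_ ?_
  · intro i; fin_cases i <;> rfl
  · intro i
    fin_cases i <;> first
      | exact isOrthogonal_coeffXY (by omega) (by omega) (by omega)
      | exact isOrthogonal_coeffXYZ (by omega) (by omega) (by omega)
      | exact isOrthogonal_coeffYCubed
      | exact isOrthogonal_coeffYFourth
  · decide +kernel
  · intro W hW
    refine relations_quotient.mem_of_degree_five W fun a b c hd ha hb hab => ?_
    have hex : ∃ i, (![(0, 0, 5), (1, 0, 4), (0, 1, 4), (2, 0, 3), (1, 1, 3), (0, 2, 3),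
        (3, 0, 2), (2, 1, 2), (3, 1, 1), (0, 3, 2), (0, 4, 1), (3, 2, 0)] :
          Fin 12 → ℕ × ℕ × ℕ) i = (a, b, c) := by
      obtain rfl : c = 5 - a - b := by omega
      interval_cases a <;> interval_cases b <;> first | omega | decide
    obtain ⟨i, hi⟩ := hex
    simpa only [hi] using hW i

lemma milnorDim_six : milnorDim 6 = 11 := by
  refine finrank_eq (d := 6)
    ![(0, 0, 6), (1, 0, 5), (0, 1, 5), (2, 0, 4), (1, 1, 4), (0, 2, 4), (3, 0, 3), (2, 1, 3),
      (3, 1, 2), (0, 3, 3), (0, 4, 2)]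
    ![coeffXY 0 0, coeffXY 1 0, coeffXY 0 1, coeffXY 2 0, coeffXY 1 1, coeffXY 0 2, coeffXY 3 0,
      coeffXY 2 1, coeffXY 3 1, coeffYCubed, coeffYFourth]
    ?_ ?_ ?_ ?_
  · intro i; fin_cases i <;> rfl
  · intro i
    fin_cases i <;> first
      | exact isOrthogonal_coeffXY (by omega) (by omega) (by omega)
      | exact isOrthogonal_coeffYCubed
      | exact isOrthogonal_coeffYFourth
  · decide +kernel
  · intro W hW
    refine relations_quotient.mem_of_degree_six W fun a b c hd ha hb hab => ?_
    have hex : ∃ i, (![(0, 0, 6), (1, 0, 5), (0, 1, 5), (2, 0, 4), (1, 1, 4), (0, 2, 4),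
        (3, 0, 3), (2, 1, 3), (3, 1, 2), (0, 3, 3), (0, 4, 2)] :
          Fin 11 → ℕ × ℕ × ℕ) i = (a, b, c) := by
      obtain rfl : c = 6 - a - b := by omega
      interval_cases a <;> interval_cases b <;> first | omega | decide
    obtain ⟨i, hi⟩ := hex
    simpa only [hi] using hW i

lemma milnorDim_of_ge_seven {d : ℕ} (hd : 7 ≤ d) : milnorDim d = 10 := by
  let ab : Fin 10 → ℕ × ℕ :=
    ![(0, 0), (1, 0), (0, 1), (2, 0), (1, 1), (0, 2), (3, 0), (2, 1), (3, 1), (0, 3)]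
  let w : Fin 10 → ℕ → ℕ → ℕ → ℚ :=
    ![coeffXY 0 0, coeffXY 1 0, coeffXY 0 1, coeffXY 2 0, coeffXY 1 1, coeffXY 0 2, coeffXY 3 0,
      coeffXY 2 1, coeffXY 3 1, coeffYCubed]
  refine finrank_eq (d := d) (fun i => ((ab i).1, (ab i).2, d - (ab i).1 - (ab i).2)) w
    ?_ ?_ ?_ ?_
  · have hab : ∀ i, (ab i).1 + (ab i).2 ≤ 7 := by decide
    intro i
    have := hab i
    dsimp only
    omega
  · intro i
    fin_cases i <;> first
      | exact isOrthogonal_coeffXY (by omega) (by omega) (by omega)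
      | exact isOrthogonal_coeffYCubed
  · intro i j
    have hz : ∀ i a b c, w i a b c = w i a b 0 := by
      intro i
      fin_cases i <;> exact fun _ _ _ => rfl
    have hdual : ∀ i j, w i (ab j).1 (ab j).2 0 = if i = j then 1 else 0 := by decide +kernel
    exact (hz ..).trans (hdual i j)
  · intro W hW
    refine relations_quotient.mem_of_degree_ge_seven hd W fun a b c hc ha hb hab => ?_
    have hex : ∃ i, ab i = (a, b) := by
      clear hc
      interval_cases a <;> interval_cases b <;> first | omega | decide
    obtain ⟨i, hi⟩ := hex
    obtain rfl : c = d - a - b := by omega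
    simpa only [hi] using hW i

end MilnorAlgebra

open MilnorAlgebra

theorem stmt18 (x y z f : MvPolynomial (Fin 3) ℂ)
    (hx : x = X 0) (hy : y = X 1) (hz : z = X 2)
    (hf : f = x ^ 5 + x * y ^ 3 * z + y ^ 4 * z + x * y ^ 4)
    (J : Ideal (MvPolynomial (Fin 3) ℂ))
    (hJ : J = Ideal.span {pderiv 0 f, pderiv 1 f, pderiv 2 f})
    (μ : ℕ → ℕ)
    (hμ : ∀ k, μ k = Module.finrank ℂ
      (Submodule.map (Ideal.Quotient.mkₐ ℂ J).toLinearMap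
        (homogeneousSubmodule (Fin 3) ℂ (k - 3)))) :
    μ 6 = 10 ∧ μ 7 = 12 ∧ μ 8 = 12 ∧ μ 9 = 11 ∧ ∀ k ≥ 10, μ k = 10 := by
  have hJ' : J = jacobianIdeal := by
    subst hf hx hy hz
    rw [hJ, jacobianIdeal]
    congr 1
    congr 1
    · simp [pderiv_X, Derivation.leibniz_pow]
      ring
    · congr 1
      · simp [pderiv_X, Derivation.leibniz_pow]
        ring
      · simp [pderiv_X, Derivation.leibniz_pow]
  subst hJ'
  have hdim : ∀ k, μ k = milnorDim (k - 3) := hμ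
  refine ⟨?_, ?_, ?_, ?_, fun k hk => ?_⟩
  · rw [hdim, milnorDim_three]
  · rw [hdim, milnorDim_four]
  · rw [hdim, milnorDim_five]
  · rw [hdim, milnorDim_six]
  · rw [hdim, milnorDim_of_ge_seven (by omega)]
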